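/- Under the sphere assumption, strong duality holds at every order of the complex hierarchy: for every d ≥ d^min, ρ_d* = ρ_d, and this common value belongs to ℝ ∪ {+∞} (i.e., it is never −∞). -/

import Mathlib

open scoped BigOperators ComplexOrder
open Classical Filter

noncomputable section

/-- Multi-indices in `ℕⁿ`. -/
abbrev MIdx (n : ℕ) := Fin n → ℕ

/-- `|α| = α₁ + ⋯ + αₙ`. -/
def mdeg {n : ℕ} (α : MIdx n) : ℕ := ∑ i, α i

/-- The monomial `z^α := z₁^{α₁} ⋯ zₙ^{αₙ}`. -/
def mpow {n : ℕ} (z : Fin n → ℂ) (α : MIdx n) : ℂ := ∏ i, z i ^ α i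

/-- Evaluation of the coefficient array `c` as the (real part of the) complex
polynomial `z ↦ Σ_{α,β} c_{α,β} z̄^α z^β`. -/
def peval {n : ℕ} (c : MIdx n → MIdx n → ℂ) (z : Fin n → ℂ) : ℝ :=
  (∑ᶠ α : MIdx n, ∑ᶠ β : MIdx n, c α β * (starRingEnd ℂ) (mpow z α) * mpow z β).re

/-- Evaluation of a holomorphic polynomial with coefficients `p`. -/
def hpeval {n : ℕ} (p : MIdx n → ℂ) (z : Fin n → ℂ) : ℂ :=
  ∑ᶠ α : MIdx n, p α * mpow z α

/-- `σ ∈ Σ_d[z]`: `σ` is a finite sum of squared moduli of holomorphic polynomials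
of degree at most `d`. -/
def IsSOSUpTo {n : ℕ} (d : ℕ) (σ : (Fin n → ℂ) → ℝ) : Prop :=
  ∃ (r : ℕ) (p : Fin r → MIdx n → ℂ),
    (∀ j α, p j α ≠ 0 → mdeg α ≤ d) ∧
    ∀ z, σ z = ∑ j, Complex.normSq (hpeval (p j) z)

/-- `σ ∈ Σ[z]`. -/
def IsSOS {n : ℕ} (σ : (Fin n → ℂ) → ℝ) : Prop := ∃ d, IsSOSUpTo d σ

/-- Hermitian coefficient array of degree at most `l` (real-valued complex polynomial). -/
def IsPolyDeg {n : ℕ} (l : ℕ) (c : MIdx n → MIdx n → ℂ) : Prop :=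
  (∀ α β, c α β ≠ 0 → mdeg α ≤ l ∧ mdeg β ≤ l) ∧
  (∀ α β, (starRingEnd ℂ) (c α β) = c β α)

/-- `c` has a nonzero coefficient `c_{α,β}` with `|α| = l` (degree exactly `l`). -/
def HasTopDeg {n : ℕ} (l : ℕ) (c : MIdx n → MIdx n → ℂ) : Prop :=
  ∃ α β, mdeg α = l ∧ mdeg β ≤ l ∧ c α β ≠ 0

/-- Multi-indices of degree at most `e`, indexing moment matrices. -/
def Idx (n e : ℕ) := {α : MIdx n // mdeg α ≤ e}

noncomputable instance {n e : ℕ} : Fintype (Idx n e) :=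
  Fintype.ofInjective
    (fun a : Idx n e => (fun i =>
      (⟨a.1 i, Nat.lt_succ_of_le (le_trans
        (Finset.single_le_sum (f := a.1) (fun j _ => Nat.zero_le _) (Finset.mem_univ i))
        a.2)⟩ : Fin (e + 1)) : Fin n → Fin (e + 1)))
    (fun a b h => Subtype.ext (funext fun i => congrArg Fin.val (congrFun h i)))

/-- Entry `(α,β)` of the localizing matrix `M(φ y)`:
`Σ_{γ,δ} φ_{γ,δ} y_{α+γ, β+δ}`. -/
def momEntry {n : ℕ} (φ y : MIdx n → MIdx n → ℂ) (α β : MIdx n) : ℂ :=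
  ∑ᶠ γ : MIdx n, ∑ᶠ δ : MIdx n, φ γ δ * y (α + γ) (β + δ)

/-- The localizing matrix `M_e(φ y)` indexed by multi-indices of degree at most `e`. -/
def momMatrix (n e : ℕ) (φ y : MIdx n → MIdx n → ℂ) :
    Matrix (Idx n e) (Idx n e) ℂ :=
  Matrix.of fun a b => momEntry φ y a.1 b.1

/-- The moment matrix `M_e(y)` indexed by multi-indices of degree at most `e`. -/
def momMatrixId (n e : ℕ) (y : MIdx n → MIdx n → ℂ) :
    Matrix (Idx n e) (Idx n e) ℂ :=
  Matrix.of fun a b => y a.1 b.1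

/-- The Riesz functional `L_y(c) = Σ_{α,β} c_{α,β} y_{α,β}` (real part). -/
def Ly {n : ℕ} (c y : MIdx n → MIdx n → ℂ) : ℝ :=
  (∑ᶠ α : MIdx n, ∑ᶠ β : MIdx n, c α β * y α β).re

/-- `y ∈ H_d`: hermitian array truncated at degree `d`. -/
def HermArr (n d : ℕ) (y : MIdx n → MIdx n → ℂ) : Prop :=
  ∀ α β : MIdx n, mdeg α ≤ d → mdeg β ≤ d → (starRingEnd ℂ) (y α β) = y β α

/-- The feasible set `K = {z : g_i(z) ≥ 0, i = 1,…,m}`. -/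
def Kset {n m : ℕ} (g : Fin m → MIdx n → MIdx n → ℂ) : Set (Fin n → ℂ) :=
  {z | ∀ i, 0 ≤ peval (g i) z}

/-- Coefficients of the polynomial `s(z) = R² − |z₁|² − ⋯ − |zₙ|²`. -/
def spherePoly (n : ℕ) (R : ℝ) : MIdx n → MIdx n → ℂ := fun α β =>
  if α = 0 ∧ β = 0 then ((R ^ 2 : ℝ) : ℂ)
  else if ∃ i : Fin n, α = Pi.single i 1 ∧ β = Pi.single i 1 then -1 else 0

/-- Feasibility for the complex moment relaxation of order `d`. -/
def MomFeas (n m d : ℕ) (g : Fin m → MIdx n → MIdx n → ℂ) (kk : Fin m → ℕ)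
    (y : MIdx n → MIdx n → ℂ) : Prop :=
  HermArr n d y ∧ y 0 0 = 1 ∧ (momMatrixId n d y).PosSemidef ∧
    ∀ i, (momMatrix n (d - kk i) (g i) y).PosSemidef

/-- `ρ_d`: optimal value of the complex moment relaxation of order `d`. -/
def rhoMom (n m d : ℕ) (f : MIdx n → MIdx n → ℂ) (g : Fin m → MIdx n → MIdx n → ℂ)
    (kk : Fin m → ℕ) : EReal :=
  sInf {x : EReal | ∃ y, MomFeas n m d g kk y ∧ x = ((Ly f y : ℝ) : EReal)}

/-- A degree-`d` sum-of-squares certificate `f − λ = Σ_{i=0}^m σ_i g_i`. -/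
def SOSCert (n m d : ℕ) (f : MIdx n → MIdx n → ℂ) (g : Fin m → MIdx n → MIdx n → ℂ)
    (kk : Fin m → ℕ) (lam : ℝ) : Prop :=
  ∃ (σ0 : (Fin n → ℂ) → ℝ) (σ : Fin m → (Fin n → ℂ) → ℝ),
    IsSOSUpTo d σ0 ∧ (∀ i, IsSOSUpTo (d - kk i) (σ i)) ∧
    ∀ z, peval f z - lam = σ0 z + ∑ i, σ i z * peval (g i) z

/-- `ρ_d*`: optimal value of the complex sum-of-squares relaxation of order `d`. -/
def rhoSOS (n m d : ℕ) (f : MIdx n → MIdx n → ℂ) (g : Fin m → MIdx n → MIdx n → ℂ)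
    (kk : Fin m → ℕ) : EReal :=
  sSup {x : EReal | ∃ lam : ℝ, SOSCert n m d f g kk lam ∧ x = ((lam : ℝ) : EReal)}

/-- `f^opt = inf_K f` as an extended real number. -/
def fOpt (n m : ℕ) (f : MIdx n → MIdx n → ℂ) (g : Fin m → MIdx n → MIdx n → ℂ) : EReal :=
  sInf {x : EReal | ∃ z ∈ Kset g, x = ((peval f z : ℝ) : EReal)}

/-- Sphere assumption: two of the constraint polynomials are `s` and `−s` where
`s(z) = R² − |z₁|² − ⋯ − |zₙ|²`. -/
def SphereAssumption (n m : ℕ) (g : Fin m → MIdx n → MIdx n → ℂ) (R : ℝ) : Prop :=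
  0 < R ∧ ∃ i₁ i₂ : Fin m, i₁ ≠ i₂ ∧ g i₁ = spherePoly n R ∧
    (∀ α β, g i₂ α β = -(spherePoly n R α β))

abbrev XX (n : ℕ) := Fin n → ℂ

def SS (n d : ℕ) : Finset (MIdx n) := Finset.univ.image (fun a : Idx n d => a.1)

lemma mem_SS {n d : ℕ} (α : MIdx n) : α ∈ SS n d ↔ mdeg α ≤ d := by
  simp only [SS, Finset.mem_image, Finset.mem_univ, true_and]
  exact ⟨fun ⟨a, ha⟩ => ha ▸ a.2, fun h => ⟨⟨α, h⟩, rfl⟩⟩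

lemma sum_Idx {n d : ℕ} {M : Type*} [AddCommMonoid M] (F : MIdx n → M) :
    ∑ a : Idx n d, F a.1 = ∑ α ∈ SS n d, F α := by
  rw [SS, Finset.sum_image]
  intro a _ b _ h
  exact Subtype.ext h

lemma mdeg_add {n : ℕ} (α β : MIdx n) : mdeg (α + β) = mdeg α + mdeg β := by
  simp [mdeg, Finset.sum_add_distrib]

lemma mdeg_single {n : ℕ} (i : Fin n) : mdeg (Pi.single i 1 : MIdx n) = 1 := by
  simp [mdeg, Pi.single_apply]

lemma mpow_add {n : ℕ} (z : XX n) (α β : MIdx n) : mpow z (α + β) = mpow z α * mpow z β := by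
  simp [mpow, pow_add, Finset.prod_mul_distrib]

lemma mpow_single {n : ℕ} (z : XX n) (i : Fin n) : mpow z (Pi.single i 1) = z i := by
  simp only [mpow, Pi.single_apply]
  rw [Finset.prod_eq_single i] <;> simp +contextual

lemma mpow_zero {n : ℕ} (z : XX n) : mpow z 0 = 1 := by
  simp [mpow]

/-- monomial function -/
def mono {n : ℕ} (α β : MIdx n) : XX n → ℂ := fun z => (starRingEnd ℂ) (mpow z α) * mpow z β

lemma finsum_SS {n d : ℕ} {M : Type*} [AddCommMonoid M] (F : MIdx n → M)
    (h : ∀ α, F α ≠ 0 → mdeg α ≤ d) : ∑ᶠ α, F α = ∑ α ∈ SS n d, F α := by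
  apply finsum_eq_sum_of_support_subset
  intro α hα
  exact (mem_SS α).2 (h α hα)

lemma finsum2_SS {n d : ℕ} {M : Type*} [AddCommMonoid M] (F : MIdx n → MIdx n → M)
    (h : ∀ α β, F α β ≠ 0 → mdeg α ≤ d ∧ mdeg β ≤ d) :
    ∑ᶠ α, ∑ᶠ β, F α β = ∑ α ∈ SS n d, ∑ β ∈ SS n d, F α β := by
  have h1 : ∀ α, ∑ᶠ β, F α β = ∑ β ∈ SS n d, F α β := fun α =>
    finsum_SS _ fun β hβ => (h α β hβ).2
  simp only [h1]
  apply finsum_SS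
  intro α hα
  obtain ⟨β, _, hb⟩ := Finset.exists_ne_zero_of_sum_ne_zero hα
  exact (h α β hb).1

lemma hpeval_eq {n d : ℕ} (p : MIdx n → ℂ) (h : ∀ α, p α ≠ 0 → mdeg α ≤ d) (z : XX n) :
    hpeval p z = ∑ α ∈ SS n d, p α * mpow z α :=
  finsum_SS _ fun α hα => h α (left_ne_zero_of_mul hα)

lemma peval_eq {n l : ℕ} (c : MIdx n → MIdx n → ℂ) (h : IsPolyDeg l c) (z : XX n) :
    ((peval c z : ℝ) : ℂ) = ∑ α ∈ SS n l, ∑ β ∈ SS n l, c α β * mono α β z := by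
  have e : ∑ᶠ α : MIdx n, ∑ᶠ β : MIdx n, c α β * (starRingEnd ℂ) (mpow z α) * mpow z β
      = ∑ α ∈ SS n l, ∑ β ∈ SS n l, c α β * mono α β z := by
    rw [finsum2_SS (d := l)]
    · simp only [mono, mul_assoc]
    · intro α β hh
      exact h.1 α β (left_ne_zero_of_mul (left_ne_zero_of_mul hh))
  rw [peval, e]
  apply Complex.conj_eq_iff_re.1
  rw [map_sum, Finset.sum_comm]
  simp only [map_sum]
  rw [Finset.sum_comm]
  conv_lhs => rw [Finset.sum_comm]
  refine Finset.sum_congr rfl fun α _ => Finset.sum_congr rfl fun β _ => ?_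
  simp only [map_mul, h.2, mono, Complex.conj_conj]
  ring

lemma Lam_peval {n l : ℕ} (Λ : (XX n → ℂ) →ₗ[ℂ] ℂ) (c : MIdx n → MIdx n → ℂ)
    (h : IsPolyDeg l c) :
    Λ (fun z => ((peval c z : ℝ) : ℂ)) =
      ∑ᶠ α : MIdx n, ∑ᶠ β : MIdx n, c α β * Λ (mono α β) := by
  rw [finsum2_SS (d := l)]
  · have : (fun z => ((peval c z : ℝ) : ℂ)) =
      ∑ α ∈ SS n l, ∑ β ∈ SS n l, c α β • mono α β := by
      funext z
      rw [peval_eq c h]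
      simp [Finset.sum_apply]
    rw [this]
    simp [map_sum]
  · intro α β hh
    exact h.1 α β (left_ne_zero_of_mul hh)

/-- square times g, expanded -/
lemma sqg_eq {n e l : ℕ} (g : MIdx n → MIdx n → ℂ) (hg : IsPolyDeg l g)
    (p : MIdx n → ℂ) (hp : ∀ α, p α ≠ 0 → mdeg α ≤ e) :
    (fun z => ((Complex.normSq (hpeval p z) * peval g z : ℝ) : ℂ)) =
      ∑ α ∈ SS n e, ∑ β ∈ SS n e, ∑ γ ∈ SS n l, ∑ δ ∈ SS n l,
        ((starRingEnd ℂ) (p α) * p β * g γ δ) • mono (α + γ) (β + δ) := by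
  funext z
  rw [Complex.ofReal_mul, peval_eq g hg, Complex.normSq_eq_conj_mul_self, hpeval_eq p hp]
  simp only [map_sum, Finset.sum_apply, Pi.smul_apply, smul_eq_mul]
  rw [Finset.sum_mul_sum, Finset.sum_mul]
  refine Finset.sum_congr rfl fun α _ => ?_
  rw [Finset.sum_mul]
  refine Finset.sum_congr rfl fun β _ => ?_
  rw [Finset.mul_sum]
  refine Finset.sum_congr rfl fun γ _ => ?_
  rw [Finset.mul_sum]
  refine Finset.sum_congr rfl fun δ _ => ?_
  simp only [mono, mpow_add, map_mul]
  ring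

lemma Lam_sqg {n e l : ℕ} (Λ : (XX n → ℂ) →ₗ[ℂ] ℂ) (g : MIdx n → MIdx n → ℂ)
    (hg : IsPolyDeg l g) (p : MIdx n → ℂ) (hp : ∀ α, p α ≠ 0 → mdeg α ≤ e) :
    Λ (fun z => ((Complex.normSq (hpeval p z) * peval g z : ℝ) : ℂ)) =
      star (fun a : Idx n e => p a.1) ⬝ᵥ
        (Matrix.mulVec (momMatrix n e g (fun α β => Λ (mono α β))) (fun a => p a.1)) := by
  rw [sqg_eq g hg p hp]
  simp only [map_sum, map_smul, smul_eq_mul, dotProduct, Matrix.mulVec, momMatrix,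
    Matrix.of_apply, Pi.star_apply]
  have hm : ∀ α β : MIdx n, momEntry g (fun α β => Λ (mono α β)) α β =
      ∑ γ ∈ SS n l, ∑ δ ∈ SS n l, g γ δ * Λ (mono (α + γ) (β + δ)) := fun α β => by
    rw [momEntry, finsum2_SS (d := l)]
    intro γ δ hh
    exact hg.1 γ δ (left_ne_zero_of_mul hh)
  simp only [hm]
  rw [sum_Idx (fun α => star (p α) * ∑ b : Idx n e,
    (∑ γ ∈ SS n l, ∑ δ ∈ SS n l, g γ δ * Λ (mono (α + γ) (b.1 + δ))) * p b.1)]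
  refine Finset.sum_congr rfl fun α _ => ?_
  rw [sum_Idx (fun β => (∑ γ ∈ SS n l, ∑ δ ∈ SS n l, g γ δ * Λ (mono (α + γ) (β + δ))) * p β),
    Finset.mul_sum]
  refine Finset.sum_congr rfl fun β _ => ?_
  rw [Finset.sum_mul, Finset.mul_sum]
  refine Finset.sum_congr rfl fun γ _ => ?_
  rw [Finset.sum_mul, Finset.mul_sum]
  refine Finset.sum_congr rfl fun δ _ => ?_
  simp only [Complex.star_def]
  ring

/-- constant one -/
def onePoly (n : ℕ) : MIdx n → MIdx n → ℂ := fun α β => if α = 0 ∧ β = 0 then 1 else 0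

lemma onePoly_deg (n : ℕ) : IsPolyDeg 0 (onePoly n) := by
  constructor
  · intro α β h
    simp only [onePoly, ne_eq, ite_eq_right_iff, not_forall] at h
    obtain ⟨⟨rfl, rfl⟩, _⟩ := h
    simp [mdeg]
  · intro α β
    simp only [onePoly, and_comm (a := β = 0)]
    split_ifs <;> simp

lemma finsum_onePoly {n : ℕ} (F : MIdx n → MIdx n → ℂ) :
    ∑ᶠ α : MIdx n, ∑ᶠ β : MIdx n, onePoly n α β * F α β = F 0 0 := by
  rw [finsum_eq_single _ 0, finsum_eq_single _ 0]
  · simp [onePoly]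
  · intro x hx
    simp [onePoly, hx]
  · intro x hx
    simp [onePoly, hx]

lemma peval_onePoly {n : ℕ} (z : XX n) : peval (onePoly n) z = 1 := by
  rw [peval]
  simp only [mul_assoc]
  rw [finsum_onePoly (fun α β => (starRingEnd ℂ) (mpow z α) * mpow z β)]
  simp [mpow_zero]

lemma momMatrix_onePoly {n e : ℕ} (y : MIdx n → MIdx n → ℂ) :
    momMatrix n e (onePoly n) y = momMatrixId n e y := by
  ext a b
  simp only [momMatrix, momMatrixId, Matrix.of_apply, momEntry]
  rw [finsum_onePoly (fun γ δ => y (a.1 + γ) (b.1 + δ))]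
  simp

/-- evaluation at (conj z, z) -/
def Phi (n : ℕ) : MvPolynomial (Fin n ⊕ Fin n) ℂ →ₗ[ℂ] (XX n → ℂ) where
  toFun P := fun z => MvPolynomial.eval (Sum.elim (fun i => (starRingEnd ℂ) (z i)) z) P
  map_add' P Q := by funext z; simp
  map_smul' c P := by funext z; simp

lemma Phi_inj (n : ℕ) : LinearMap.ker (Phi n) = ⊥ := by
  rw [LinearMap.ker_eq_bot']
  intro P hP
  let θ : Fin n ⊕ Fin n → MvPolynomial (Fin n ⊕ Fin n) ℂ :=
    Sum.elim (fun i => MvPolynomial.X (Sum.inl i) - MvPolynomial.C Complex.I * MvPolynomial.X (Sum.inr i))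
      (fun i => MvPolynomial.X (Sum.inl i) + MvPolynomial.C Complex.I * MvPolynomial.X (Sum.inr i))
  have key : ∀ w : Fin n ⊕ Fin n → ℂ, MvPolynomial.eval w (MvPolynomial.bind₁ θ P) =
      MvPolynomial.eval (Sum.elim (fun i => w (Sum.inl i) - Complex.I * w (Sum.inr i))
        (fun i => w (Sum.inl i) + Complex.I * w (Sum.inr i))) P := by
    intro w
    rw [← MvPolynomial.coe_aeval_eq_eval, ← MvPolynomial.coe_aeval_eq_eval]
    simp only [RingHom.coe_coe, MvPolynomial.aeval_bind₁]
    congr 2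
    funext j
    rcases j with i | i <;> simp [θ]
  have hQ : MvPolynomial.bind₁ θ P = 0 := by
    apply MvPolynomial.funext_set (fun _ => Set.range (fun r : ℝ => (r : ℂ)))
      (fun _ => Set.infinite_range_of_injective Complex.ofReal_injective)
    intro w hw
    rw [key, map_zero]
    have hw' : ∀ j, (starRingEnd ℂ) (w j) = w j := by
      intro j
      obtain ⟨r, hr⟩ := hw j trivial
      rw [← hr]; simp
    have := congrFun hP (fun i => w (Sum.inl i) + Complex.I * w (Sum.inr i))
    simp only [Phi, LinearMap.coe_mk, AddHom.coe_mk, Pi.zero_apply, map_add, map_mul, hw',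
      Complex.conj_I, neg_mul, ← sub_eq_add_neg] at this
    exact this
  apply MvPolynomial.funext
  intro w
  have := key (Sum.elim (fun i => (w (Sum.inl i) + w (Sum.inr i)) / 2)
    (fun i => (w (Sum.inr i) - w (Sum.inl i)) / (2 * Complex.I)))
  rw [hQ, map_zero] at this
  rw [map_zero, this]
  congr 2
  funext j
  have hI := Complex.I_ne_zero
  rcases j with i | i <;> simp <;> field_simp <;> ring

lemma exists_Lam {n : ℕ} (y : MIdx n → MIdx n → ℂ) :
    ∃ Λ : (XX n → ℂ) →ₗ[ℂ] ℂ, ∀ α β, Λ (mono α β) = y α β := by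
  obtain ⟨G, hG⟩ := LinearMap.exists_leftInverse_of_injective (Phi n) (Phi_inj n)
  let F := (MvPolynomial.basisMonomials (Fin n ⊕ Fin n) ℂ).constr ℂ
    (fun s => y (fun i => s (Sum.inl i)) (fun i => s (Sum.inr i)))
  refine ⟨F ∘ₗ G, fun α β => ?_⟩
  let s : Fin n ⊕ Fin n →₀ ℕ := Finsupp.equivFunOnFinite.symm (Sum.elim α β)
  have hm : mono α β = Phi n (MvPolynomial.monomial s 1) := by
    funext z
    simp [mono, Phi, MvPolynomial.eval_monomial, Finsupp.prod_fintype, s, mpow]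
  have hF : F (MvPolynomial.monomial s 1) = y α β := by
    have := (MvPolynomial.basisMonomials (Fin n ⊕ Fin n) ℂ).constr_basis ℂ
      (fun s => y (fun i => s (Sum.inl i)) (fun i => s (Sum.inr i))) s
    simpa [s] using this
  rw [hm, LinearMap.comp_apply, ← LinearMap.comp_apply G, hG]
  exact hF

lemma Lam_sos {n e l : ℕ} (Λ : (XX n → ℂ) →ₗ[ℂ] ℂ) (g : MIdx n → MIdx n → ℂ)
    (hg : IsPolyDeg l g) (σ : XX n → ℝ) (hσ : IsSOSUpTo e σ)
    (hM : (momMatrix n e g (fun α β => Λ (mono α β))).PosSemidef) :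
    0 ≤ (Λ (fun z => ((σ z * peval g z : ℝ) : ℂ))).re := by
  obtain ⟨r, p, hp, hs⟩ := hσ
  have : (fun z => ((σ z * peval g z : ℝ) : ℂ)) =
      ∑ j, (fun z => ((Complex.normSq (hpeval (p j) z) * peval g z : ℝ) : ℂ)) := by
    funext z
    rw [hs, Finset.sum_mul, Finset.sum_apply]
    push_cast
    rfl
  rw [this, map_sum, Complex.re_sum]
  refine Finset.sum_nonneg fun j _ => ?_
  rw [Lam_sqg Λ g hg (p j) (hp j)]
  exact (Complex.le_def.1 (hM.dotProduct_mulVec_nonneg _)).1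

lemma weak_duality {n m d k : ℕ} {f : MIdx n → MIdx n → ℂ} {g : Fin m → MIdx n → MIdx n → ℂ}
    {kk : Fin m → ℕ} (hf : IsPolyDeg k f) (hg : ∀ i, IsPolyDeg (kk i) (g i)) {lam : ℝ}
    (hc : SOSCert n m d f g kk lam) {y : MIdx n → MIdx n → ℂ} (hy : MomFeas n m d g kk y) :
    lam ≤ Ly f y := by
  obtain ⟨Λ, hΛ⟩ := exists_Lam y
  have hyy : (fun α β => Λ (mono α β)) = y := by funext α β; exact hΛ α β
  obtain ⟨σ0, σ, h0, hσ, he⟩ := hc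
  obtain ⟨-, hy1, hM0, hM⟩ := hy
  have e1 : (fun z => ((peval f z : ℝ) : ℂ)) =
      (lam : ℂ) • mono 0 0 + (fun z => ((σ0 z * peval (onePoly n) z : ℝ) : ℂ)) +
        ∑ i, (fun z => ((σ i z * peval (g i) z : ℝ) : ℂ)) := by
    funext z
    have := he z
    have h2 : peval f z = lam + σ0 z + ∑ i, σ i z * peval (g i) z := by linarith
    rw [h2]
    simp [mono, mpow_zero, peval_onePoly, Finset.sum_apply]
  have e2 := congrArg Complex.re (congrArg Λ e1)
  rw [Lam_peval Λ f hf] at e2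
  simp only [hΛ] at e2
  rw [Ly, e2, map_add, map_add, map_smul, hΛ, hy1, map_sum]
  have a0 := Lam_sos Λ (onePoly n) (onePoly_deg n) σ0 h0 (by rw [hyy, momMatrix_onePoly]; exact hM0)
  have ai : 0 ≤ (∑ i, Λ (fun z => ((σ i z * peval (g i) z : ℝ) : ℂ))).re := by
    rw [Complex.re_sum]
    exact Finset.sum_nonneg fun i _ => Lam_sos Λ (g i) (hg i) (σ i) (hσ i) (by rw [hyy]; exact hM i)
  simp only [Complex.add_re, smul_eq_mul, mul_one, Complex.ofReal_re]
  linarith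

lemma sos_add {n e : ℕ} {σ τ : XX n → ℝ} (h1 : IsSOSUpTo e σ) (h2 : IsSOSUpTo e τ) :
    IsSOSUpTo e (fun z => σ z + τ z) := by
  obtain ⟨r, p, hp, hs⟩ := h1
  obtain ⟨r', p', hp', hs'⟩ := h2
  refine ⟨r + r', Fin.append p p', ?_, ?_⟩
  · intro j
    refine Fin.addCases (fun i => ?_) (fun i => ?_) j
    · simpa using hp i
    · simpa using hp' i
  · intro z
    simp [Fin.sum_univ_add, hs, hs']

lemma sos_smul {n e : ℕ} {σ : XX n → ℝ} {c : ℝ} (hc : 0 ≤ c) (h1 : IsSOSUpTo e σ) :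
    IsSOSUpTo e (fun z => c * σ z) := by
  obtain ⟨r, p, hp, hs⟩ := h1
  refine ⟨r, fun j α => ((Real.sqrt c : ℝ) : ℂ) * p j α, ?_, ?_⟩
  · intro j α h
    exact hp j α (right_ne_zero_of_mul h)
  · intro z
    beta_reduce
    rw [hs, Finset.mul_sum]
    refine Finset.sum_congr rfl fun j _ => ?_
    have : hpeval (fun α => ((Real.sqrt c : ℝ) : ℂ) * p j α) z =
        ((Real.sqrt c : ℝ) : ℂ) * hpeval (p j) z := by
      simp only [hpeval, mul_assoc, ← smul_eq_mul]
      rw [smul_finsum]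
      simp only [smul_assoc]
    rw [this, Complex.normSq_mul, Complex.normSq_ofReal, Real.mul_self_sqrt hc]

lemma sos_zero {n e : ℕ} : IsSOSUpTo e (fun _ : XX n => (0 : ℝ)) :=
  ⟨0, Fin.elim0, fun j => j.elim0, fun z => by simp⟩

/-- the SOS cone, as functions -/
def CC (n m d : ℕ) (g : Fin m → MIdx n → MIdx n → ℂ) (kk : Fin m → ℕ) :
    PointedCone ℝ (XX n → ℝ) where
  carrier := {h | ∃ (σ0 : (Fin n → ℂ) → ℝ) (σ : Fin m → (Fin n → ℂ) → ℝ),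
    IsSOSUpTo d σ0 ∧ (∀ i, IsSOSUpTo (d - kk i) (σ i)) ∧
    ∀ z, h z = σ0 z + ∑ i, σ i z * peval (g i) z}
  zero_mem' := ⟨_, fun _ => _, sos_zero, fun _ => sos_zero, fun z => by simp⟩
  add_mem' := by
    rintro a b ⟨σ0, σ, h0, h1, h2⟩ ⟨τ0, τ, k0, k1, k2⟩
    refine ⟨_, fun i => _, sos_add h0 k0, fun i => sos_add (h1 i) (k1 i), fun z => ?_⟩
    simp only [Pi.add_apply, h2, k2, add_mul, Finset.sum_add_distrib]
    ring
  smul_mem' := by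
    rintro ⟨c, hc⟩ a ⟨σ0, σ, h0, h1, h2⟩
    refine ⟨_, fun i => _, sos_smul hc h0, fun i => sos_smul hc (h1 i), fun z => ?_⟩
    have : ((⟨c, hc⟩ : {c : ℝ // 0 ≤ c}) • a) z = c * a z := rfl
    rw [this, h2, mul_add, Finset.mul_sum]
    simp only [mul_assoc]

section cone
variable {n m d : ℕ} {g : Fin m → MIdx n → MIdx n → ℂ} {kk : Fin m → ℕ}

lemma CC_smul {c : ℝ} (hc : 0 ≤ c) {h : XX n → ℝ} (hh : h ∈ CC n m d g kk) :
    c • h ∈ CC n m d g kk := (CC n m d g kk).smul_mem hc hh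

lemma sos_sq {e : ℕ} {p : MIdx n → ℂ} (hp : ∀ α, p α ≠ 0 → mdeg α ≤ e) :
    IsSOSUpTo e (fun z => Complex.normSq (hpeval p z)) :=
  ⟨1, fun _ => p, fun _ => hp, fun z => by simp⟩

lemma CC_sq {p : MIdx n → ℂ} (hp : ∀ α, p α ≠ 0 → mdeg α ≤ d) :
    (fun z => Complex.normSq (hpeval p z)) ∈ CC n m d g kk :=
  ⟨_, fun _ => _, sos_sq hp, fun _ => sos_zero, fun z => by simp⟩

lemma CC_sqg (i : Fin m) {p : MIdx n → ℂ} (hp : ∀ α, p α ≠ 0 → mdeg α ≤ d - kk i) :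
    (fun z => Complex.normSq (hpeval p z) * peval (g i) z) ∈ CC n m d g kk := by
  refine ⟨_, fun j => if j = i then (fun z => Complex.normSq (hpeval p z)) else fun _ => 0,
    sos_zero, fun j => ?_, fun z => ?_⟩
  · by_cases h : j = i
    · subst h; simpa using sos_sq hp
    · simpa [h] using sos_zero
  · rw [Finset.sum_eq_single i] <;> simp +contextual

lemma hpeval_single (α : MIdx n) (z : XX n) :
    hpeval (fun γ => if γ = α then 1 else 0) z = mpow z α := by
  rw [hpeval, finsum_eq_single _ α] <;> simp +contextual

lemma single_deg {e : ℕ} {α : MIdx n} (h : mdeg α ≤ e) (γ : MIdx n)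
    (hγ : (if γ = α then (1 : ℂ) else 0) ≠ 0) : mdeg γ ≤ e := by
  by_cases h' : γ = α
  · rwa [h']
  · simp [h'] at hγ

lemma CC_mono {α : MIdx n} (h : mdeg α ≤ d) :
    (fun z => Complex.normSq (mpow z α)) ∈ CC n m d g kk := by
  have := CC_sq (m := m) (g := g) (kk := kk) (single_deg h)
  simpa only [hpeval_single] using this

lemma CC_one : (fun _ => (1 : ℝ)) ∈ CC n m d g kk := by
  have := CC_mono (d := d) (m := m) (g := g) (kk := kk) (α := (0 : MIdx n)) (by simp [mdeg])
  simpa [mpow_zero] using this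

lemma spherePoly_eq (n : ℕ) (R : ℝ) (α β : MIdx n) : spherePoly n R α β =
    (if α = 0 ∧ β = 0 then ((R ^ 2 : ℝ) : ℂ) else 0) +
      ∑ i : Fin n, (if α = Pi.single i 1 ∧ β = Pi.single i 1 then (-1 : ℂ) else 0) := by
  have inj : ∀ i j : Fin n, (Pi.single i 1 : MIdx n) = Pi.single j 1 → i = j := by
    intro i j h
    by_contra hne
    have := congrFun h i
    simp [Pi.single_apply, hne] at this
  rw [spherePoly]
  split_ifs with h1 h2
  · rw [Finset.sum_eq_zero]
    · simp
    · intro i _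
      rw [if_neg]
      rintro ⟨h, -⟩
      have := congrFun (h1.1.symm.trans h) i
      simp at this
  · obtain ⟨i, hi⟩ := h2
    rw [Finset.sum_eq_single i]
    · simp [hi]
    · intro j _ hj
      rw [if_neg]
      rintro ⟨h, -⟩
      exact hj (inj _ _ (h.symm.trans hi.1))
    · simp
  · rw [Finset.sum_eq_zero]
    · simp
    · intro i _
      rw [if_neg]
      exact fun h => h2 ⟨i, h⟩

lemma sphere_deg {R : ℝ} {α β : MIdx n} (h : spherePoly n R α β ≠ 0) :
    mdeg α ≤ 1 ∧ mdeg β ≤ 1 := by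
  rw [spherePoly] at h
  split_ifs at h with h1 h2
  · simp [h1.1, h1.2, mdeg]
  · obtain ⟨i, h3, h4⟩ := h2
    rw [h3, h4, mdeg_single]; simp
  · exact absurd rfl h

lemma peval_sphere (R : ℝ) (z : XX n) :
    peval (spherePoly n R) z = R ^ 2 - ∑ i, Complex.normSq (z i) := by
  rw [peval, finsum2_SS (d := 1)]
  · have h0 : (0 : MIdx n) ∈ SS n 1 := (mem_SS _).2 (by simp [mdeg])
    have hi : ∀ i : Fin n, (Pi.single i 1 : MIdx n) ∈ SS n 1 := fun i =>
      (mem_SS _).2 (by rw [mdeg_single])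
    have key : ∀ (a : MIdx n) (c : ℂ), a ∈ SS n 1 → ∑ α ∈ SS n 1, ∑ β ∈ SS n 1,
        (if α = a ∧ β = a then c else 0) * ((starRingEnd ℂ) (mpow z α) * mpow z β) =
          c * ((starRingEnd ℂ) (mpow z a) * mpow z a) := by
      intro a c ha
      rw [Finset.sum_eq_single_of_mem a ha, Finset.sum_eq_single_of_mem a ha]
      · simp
      · intro b _ hb; simp [hb]
      · intro b _ hb; simp [hb]
    have : ∑ α ∈ SS n 1, ∑ β ∈ SS n 1, spherePoly n R α β * (starRingEnd ℂ) (mpow z α) * mpow z β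
        = ((R ^ 2 : ℝ) : ℂ) + ∑ i, -((Complex.normSq (z i) : ℝ) : ℂ) := by
      simp only [spherePoly_eq, mul_assoc, add_mul, Finset.sum_add_distrib, Finset.sum_mul]
      rw [key 0 _ h0]
      congr 1
      · simp [mpow_zero]
      · have e1 : ∀ α : MIdx n, ∑ β ∈ SS n 1, ∑ i : Fin n,
            (if α = Pi.single i 1 ∧ β = Pi.single i 1 then (-1 : ℂ) else 0) *
              ((starRingEnd ℂ) (mpow z α) * mpow z β) = ∑ i : Fin n, ∑ β ∈ SS n 1,
            (if α = Pi.single i 1 ∧ β = Pi.single i 1 then (-1 : ℂ) else 0) *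
              ((starRingEnd ℂ) (mpow z α) * mpow z β) := fun α => Finset.sum_comm
        simp only [e1]
        rw [Finset.sum_comm]
        refine Finset.sum_congr rfl fun i _ => ?_
        rw [key _ _ (hi i), mpow_single, Complex.normSq_eq_conj_mul_self]
        ring
    rw [this]
    simp [Complex.re_sum, sub_eq_add_neg, ← Complex.ofReal_pow]
  · intro α β h
    exact sphere_deg (left_ne_zero_of_mul (left_ne_zero_of_mul h))

lemma CC_ball {R : ℝ} (i₁ : Fin m) (h1 : g i₁ = spherePoly n R) (hk : kk i₁ ≤ 1) (j : ℕ) :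
    ∀ α : MIdx n, mdeg α = j → j ≤ d →
      ∃ N : ℝ, (fun z => N - Complex.normSq (mpow z α)) ∈ CC n m d g kk := by
  induction j with
  | zero =>
    intro α hα _
    have : α = 0 := by
      funext i
      exact (Finset.sum_eq_zero_iff.1 hα) i (Finset.mem_univ i)
    subst this
    refine ⟨1, ?_⟩
    have := (CC n m d g kk).zero_mem
    convert this using 1
    funext z
    simp [mpow_zero]
  | succ j ih =>
    intro α hα hj
    have : ∃ i, α i ≠ 0 := by
      by_contra! h
      have : mdeg α = 0 := Finset.sum_eq_zero fun i _ => h i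
      omega
    obtain ⟨i, hi⟩ := this
    obtain ⟨α', rfl⟩ : ∃ α' : MIdx n, α = α' + Pi.single i 1 := by
      refine ⟨α - Pi.single i 1, ?_⟩
      funext l
      by_cases h : l = i
      · subst h; simp; omega
      · simp [h]
    rw [mdeg_add, mdeg_single] at hα
    obtain ⟨N, hN⟩ := ih α' (by omega) (by omega)
    refine ⟨R ^ 2 * N, ?_⟩
    have a1 := CC_smul (sq_nonneg R) hN
    have a2 : (fun z => Complex.normSq (mpow z α') * peval (g i₁) z) ∈ CC n m d g kk := by
      have := CC_sqg (d := d) (g := g) (kk := kk) i₁ (single_deg (α := α') (e := d - kk i₁) (by omega))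
      simpa only [hpeval_single] using this
    have a3 : ∑ l ∈ Finset.univ.erase i, (fun z => Complex.normSq (mpow z (α' + Pi.single l 1)))
        ∈ CC n m d g kk := Submodule.sum_mem _ fun l _ => CC_mono (by
          rw [mdeg_add, mdeg_single]; omega)
    have := (CC n m d g kk).add_mem ((CC n m d g kk).add_mem a1 a2) a3
    convert this using 1
    funext z
    have hs : ∑ l, Complex.normSq (z l) = Complex.normSq (z i) +
        ∑ l ∈ Finset.univ.erase i, Complex.normSq (z l) :=
      (Finset.add_sum_erase _ _ (Finset.mem_univ i)).symm
    simp only [Pi.add_apply, Pi.smul_apply, Finset.sum_apply, smul_eq_mul, h1, peval_sphere,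
      mpow_add, mpow_single, Complex.normSq_mul, hs, ← Finset.mul_sum]
    ring

/-- real polynomial functions of degree at most d -/
def VV (n d : ℕ) : Submodule ℝ (XX n → ℝ) :=
  Submodule.span ℝ {h | ∃ (u : ℂ) (α β : MIdx n), mdeg α ≤ d ∧ mdeg β ≤ d ∧
    h = fun z => (u * mono α β z).re}

lemma VV_mono (u : ℂ) {α β : MIdx n} (ha : mdeg α ≤ d) (hb : mdeg β ≤ d) :
    (fun z => (u * mono α β z).re) ∈ VV n d :=
  Submodule.subset_span ⟨u, α, β, ha, hb, rfl⟩

lemma CC_unit_mono {R : ℝ} (i₁ : Fin m) (h1 : g i₁ = spherePoly n R) (hk : kk i₁ ≤ 1)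
    (u : ℂ) {α β : MIdx n} (ha : mdeg α ≤ d) (hb : mdeg β ≤ d) :
    ∃ N : ℝ, (fun z => N + (u * mono α β z).re) ∈ CC n m d g kk := by
  obtain ⟨A, hA⟩ := CC_ball (d := d) i₁ h1 hk _ α rfl ha
  obtain ⟨B, hB⟩ := CC_ball (d := d) i₁ h1 hk _ β rfl hb
  have hp : ∀ γ : MIdx n, ((if γ = α then (1 : ℂ) else 0) + (if γ = β then u else 0)) ≠ 0 →
      mdeg γ ≤ d := by
    intro γ h
    by_cases h1 : γ = α
    · rwa [h1]
    · by_cases h2 : γ = β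
      · rwa [h2]
      · simp [h1, h2] at h
  have hS := CC_sq (m := m) (g := g) (kk := kk) hp
  have a := CC_smul (c := 1 / 2) (by norm_num) ((CC n m d g kk).add_mem
    ((CC n m d g kk).add_mem hS hA) (CC_smul (Complex.normSq_nonneg u) hB))
  refine ⟨1 / 2 * (A + Complex.normSq u * B), ?_⟩
  convert a using 1
  funext z
  have e : hpeval (fun γ => (if γ = α then (1 : ℂ) else 0) + (if γ = β then u else 0)) z =
      mpow z α + u * mpow z β := by
    rw [hpeval_eq _ hp]
    simp only [add_mul, Finset.sum_add_distrib, ite_mul, zero_mul, one_mul, Finset.sum_ite_eq',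
      mem_SS, ha, hb, if_true]
  simp only [Pi.smul_apply, Pi.add_apply, smul_eq_mul, e, mono]
  simp only [Complex.normSq_apply, Complex.add_re, Complex.add_im, Complex.mul_re, Complex.mul_im,
    Complex.conj_re, Complex.conj_im]
  ring

lemma CC_unit {R : ℝ} (i₁ : Fin m) (h1 : g i₁ = spherePoly n R) (hk : kk i₁ ≤ 1)
    {v : XX n → ℝ} (hv : v ∈ VV n d) :
    (∃ N : ℝ, (fun z => N + v z) ∈ CC n m d g kk) ∧
      (∃ N : ℝ, (fun z => N - v z) ∈ CC n m d g kk) := by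
  induction hv using Submodule.span_induction with
  | mem x hx =>
    obtain ⟨u, α, β, ha, hb, rfl⟩ := hx
    refine ⟨CC_unit_mono i₁ h1 hk u ha hb, ?_⟩
    have := CC_unit_mono (d := d) i₁ h1 hk (-u) ha hb
    simpa [sub_eq_add_neg, -Complex.mul_re, neg_mul, Complex.neg_re] using this
  | zero =>
    have : (fun _ => (0 : ℝ)) ∈ CC n m d g kk := (CC n m d g kk).zero_mem
    exact ⟨⟨0, by simpa using this⟩, ⟨0, by simpa using this⟩⟩
  | add x y _ _ hx hy =>
    obtain ⟨⟨A, hA⟩, ⟨B, hB⟩⟩ := hx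
    obtain ⟨⟨A', hA'⟩, ⟨B', hB'⟩⟩ := hy
    refine ⟨⟨A + A', ?_⟩, ⟨B + B', ?_⟩⟩
    · convert (CC n m d g kk).add_mem hA hA' using 1
      funext z; simp only [Pi.add_apply]; ring
    · convert (CC n m d g kk).add_mem hB hB' using 1
      funext z; simp only [Pi.add_apply]; ring
  | smul a x _ hx =>
    obtain ⟨⟨A, hA⟩, ⟨B, hB⟩⟩ := hx
    rcases le_total 0 a with ha | ha
    · refine ⟨⟨a * A, ?_⟩, ⟨a * B, ?_⟩⟩
      · convert CC_smul ha hA using 1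
        funext z; simp only [Pi.smul_apply, smul_eq_mul]; ring
      · convert CC_smul ha hB using 1
        funext z; simp only [Pi.smul_apply, smul_eq_mul]; ring
    · have ha' : 0 ≤ -a := by linarith
      refine ⟨⟨-a * B, ?_⟩, ⟨-a * A, ?_⟩⟩
      · convert CC_smul ha' hB using 1
        funext z; simp only [Pi.smul_apply, smul_eq_mul]; ring
      · convert CC_smul ha' hA using 1
        funext z; simp only [Pi.smul_apply, smul_eq_mul]; ring

end cone

lemma sep {E : Type*} [AddCommGroup E] [Module ℝ E] (C : PointedCone ℝ E) (e h : E)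
    (he : e ∈ C) (unit : ∀ y, ∃ N : ℝ, N • e + y ∈ C) (hh : h ∉ C) :
    ∃ L : E →ₗ[ℝ] ℝ, L e = 1 ∧ L h ≤ 0 ∧ ∀ x ∈ C, 0 ≤ L x := by
  have hsm : ∀ {c : ℝ}, 0 ≤ c → ∀ {x : E}, x ∈ C → c • x ∈ C := fun {c} hc {x} hx =>
    C.smul_mem hc hx
  have he0 : e ≠ 0 := by
    rintro rfl
    obtain ⟨N, hN⟩ := unit h
    simp at hN
    exact hh hN
  let C' : PointedCone ℝ E :=
    { carrier := {x | ∃ c ∈ C, ∃ s : ℝ, 0 ≤ s ∧ x = c - s • h}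
      zero_mem' := ⟨0, C.zero_mem, 0, le_rfl, by simp⟩
      add_mem' := by
        rintro a b ⟨c, hc, s, hs, rfl⟩ ⟨c', hc', s', hs', rfl⟩
        exact ⟨c + c', C.add_mem hc hc', s + s', by positivity, by rw [add_smul]; abel⟩
      smul_mem' := by
        rintro ⟨t, ht⟩ a ⟨c, hc, s, hs, rfl⟩
        refine ⟨t • c, hsm ht hc, t * s, by positivity, ?_⟩
        change t • (c - s • h) = _
        rw [smul_sub, smul_smul] }
  have hCC : ∀ x ∈ C, x ∈ C' := fun x hx => ⟨x, hx, 0, le_rfl, by simp⟩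
  have hneg : ∀ a : ℝ, a • e ∈ C' → 0 ≤ a := by
    rintro a ⟨c, hc, s, hs, hx⟩
    by_contra! ha
    rcases hs.eq_or_lt with h0 | h0
    · subst h0
      simp at hx
      obtain ⟨N, hN⟩ := unit h
      apply hh
      have h1 : (|N| / (-a)) • c ∈ C := hsm (by have : 0 < -a := by linarith
                                                positivity) hc
      have h2 := C.add_mem (C.add_mem h1 hN) (hsm (c := |N| - N) (by linarith [le_abs_self N]) he)
      convert h2 using 1
      rw [← hx, smul_smul]
      have : |N| / (-a) * a = -|N| := by
        have : a ≠ 0 := ha.ne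
        field_simp
      rw [this]
      module
    · apply hh
      have h1 := hsm (c := s⁻¹) (by positivity) (C.add_mem hc (hsm (c := -a) (by linarith) he))
      convert h1 using 1
      have : c + (-a) • e = s • h := by
        rw [neg_smul, hx]; abel
      rw [this, smul_smul, inv_mul_cancel₀ h0.ne', one_smul]
  obtain ⟨L, hL, hpos⟩ := riesz_extension C' (LinearPMap.mkSpanSingleton e (1 : ℝ) he0)
    (by
      rintro ⟨x, hx⟩ hxC
      obtain ⟨a, rfl⟩ := Submodule.mem_span_singleton.1 hx
      rw [LinearPMap.mkSpanSingleton'_apply]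
      simpa using hneg a hxC)
    (by
      intro y
      obtain ⟨N, hN⟩ := unit y
      exact ⟨⟨N • e, Submodule.mem_span_singleton.2 ⟨N, rfl⟩⟩, hCC _ hN⟩)
  refine ⟨L, ?_, ?_, fun x hx => hpos x (hCC x hx)⟩
  · have := hL ⟨e, Submodule.mem_span_singleton_self e⟩
    rw [LinearPMap.mkSpanSingleton_apply] at this
    exact this
  · have := hpos (-h) ⟨0, C.zero_mem, 1, by norm_num, by simp⟩
    rw [map_neg] at this
    linarith

/-- complexification of a real functional -/
def cplx {n : ℕ} (L : (XX n → ℝ) →ₗ[ℝ] ℝ) : (XX n → ℂ) →ₗ[ℂ] ℂ where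
  toFun h := ⟨L (fun z => (h z).re), L (fun z => (h z).im)⟩
  map_add' a b := by
    apply Complex.ext
    · exact L.map_add (fun z => (a z).re) (fun z => (b z).re)
    · exact L.map_add (fun z => (a z).im) (fun z => (b z).im)
  map_smul' c a := by
    have e1 : (fun z => ((c • a) z).re) = c.re • (fun z => (a z).re) - c.im • (fun z => (a z).im) := by
      funext z; simp
    have e2 : (fun z => ((c • a) z).im) = c.re • (fun z => (a z).im) + c.im • (fun z => (a z).re) := by
      funext z; simp
    rw [e1, e2]
    apply Complex.ext <;> simp

lemma cplx_ofReal {n : ℕ} (L : (XX n → ℝ) →ₗ[ℝ] ℝ) (h : XX n → ℝ) :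
    cplx L (fun z => (h z : ℂ)) = (L h : ℂ) := by
  apply Complex.ext
  · simp [cplx]
  · have : L (fun _ => (0 : ℝ)) = 0 := L.map_zero
    simp [cplx, this]

lemma cplx_mono {n : ℕ} (L : (XX n → ℝ) →ₗ[ℝ] ℝ) (α β : MIdx n) :
    (starRingEnd ℂ) (cplx L (mono α β)) = cplx L (mono β α) := by
  have e : ∀ z, mono β α z = (starRingEnd ℂ) (mono α β z) := fun z => by
    simp [mono, mul_comm]
  apply Complex.ext
  · simp only [cplx, LinearMap.coe_mk, AddHom.coe_mk, e, Complex.conj_re]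
  · simp only [cplx, LinearMap.coe_mk, AddHom.coe_mk, e, Complex.conj_im]
    rw [← map_neg]
    rfl

lemma sqg_VV {n d e l : ℕ} (hel : e + l ≤ d) (g : MIdx n → MIdx n → ℂ) (hg : IsPolyDeg l g)
    (p : MIdx n → ℂ) (hp : ∀ α, p α ≠ 0 → mdeg α ≤ e) :
    (fun z => Complex.normSq (hpeval p z) * peval g z) ∈ VV n d := by
  have h := sqg_eq g hg p hp
  have h2 : (fun z => Complex.normSq (hpeval p z) * peval g z) =
      ∑ α ∈ SS n e, ∑ β ∈ SS n e, ∑ γ ∈ SS n l, ∑ δ ∈ SS n l,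
        fun z => (((starRingEnd ℂ) (p α) * p β * g γ δ) * mono (α + γ) (β + δ) z).re := by
    funext z
    have := congrArg Complex.re (congrFun h z)
    rw [Complex.ofReal_re] at this
    rw [this]
    simp only [Finset.sum_apply, Complex.re_sum, Pi.smul_apply, smul_eq_mul]
  rw [h2]
  refine Submodule.sum_mem _ fun α ha => Submodule.sum_mem _ fun β hb =>
    Submodule.sum_mem _ fun γ hc => Submodule.sum_mem _ fun δ hd => ?_
  rw [mem_SS] at ha hb hc hd
  exact VV_mono _ (by rw [mdeg_add]; omega) (by rw [mdeg_add]; omega)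

lemma one_VV {n d : ℕ} : (fun _ => (1 : ℝ)) ∈ VV n d := by
  have := VV_mono (n := n) (d := d) 1 (α := 0) (β := 0) (by simp [mdeg]) (by simp [mdeg])
  simpa [mono, mpow_zero] using this

lemma peval_VV {n d l : ℕ} (hl : l ≤ d) (g : MIdx n → MIdx n → ℂ) (hg : IsPolyDeg l g) :
    (fun z => peval g z) ∈ VV n d := by
  have := sqg_VV (e := 0) (d := d) (by omega) g hg _ (single_deg (α := 0) (by simp [mdeg]))
  simpa [hpeval_single, mpow_zero] using this

lemma psd_of {n d e l : ℕ} (hel : e + l ≤ d) (L : (XX n → ℝ) →ₗ[ℝ] ℝ)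
    (g : MIdx n → MIdx n → ℂ) (hg : IsPolyDeg l g)
    (hL : ∀ p : MIdx n → ℂ, (∀ α, p α ≠ 0 → mdeg α ≤ e) →
      0 ≤ L (fun z => Complex.normSq (hpeval p z) * peval g z)) :
    (momMatrix n e g (fun α β => cplx L (mono α β))).PosSemidef := by
  apply Matrix.PosSemidef.of_dotProduct_mulVec_nonneg
  · ext a b
    have hm : ∀ α β : MIdx n, momEntry g (fun α β => cplx L (mono α β)) α β =
        ∑ γ ∈ SS n l, ∑ δ ∈ SS n l, g γ δ * cplx L (mono (α + γ) (β + δ)) := fun α β => by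
      rw [momEntry, finsum2_SS (d := l)]
      intro γ δ hh
      exact hg.1 γ δ (left_ne_zero_of_mul hh)
    simp only [Matrix.conjTranspose_apply, momMatrix, Matrix.of_apply, hm, Complex.star_def, map_sum,
      map_mul, hg.2, cplx_mono]
    rw [Finset.sum_comm]
  · intro x
    let p : MIdx n → ℂ := fun α => if h : mdeg α ≤ e then x ⟨α, h⟩ else 0
    have hp : ∀ α, p α ≠ 0 → mdeg α ≤ e := by
      intro α h
      by_contra h'
      simp [p, h'] at h
    have hx : (fun a : Idx n e => p a.1) = x := by
      funext a
      have := a.2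
      simp [p, this]
      rfl
    have := Lam_sqg (cplx L) g hg p hp
    rw [hx] at this
    rw [← this, cplx_ofReal L (fun z => Complex.normSq (hpeval p z) * peval g z)]
    exact_mod_cast hL p hp

lemma strong {n m d k : ℕ} {f : MIdx n → MIdx n → ℂ} {g : Fin m → MIdx n → MIdx n → ℂ}
    {kk : Fin m → ℕ} (hf : IsPolyDeg k f) (hg : ∀ i, IsPolyDeg (kk i) (g i)) (hkd : k ≤ d)
    (hkkd : ∀ i, kk i ≤ d)
    {R : ℝ} (i₁ : Fin m) (h1 : g i₁ = spherePoly n R) (hk : kk i₁ ≤ 1) {lam : ℝ}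
    (hc : ¬ SOSCert n m d f g kk lam) : ∃ y, MomFeas n m d g kk y ∧ Ly f y ≤ lam := by
  let e : VV n d := ⟨fun _ => 1, one_VV⟩
  let h : VV n d := ⟨fun z => peval f z, peval_VV hkd f hf⟩ - lam • e
  obtain ⟨L, hLe, hLh, hLC⟩ := sep ((CC n m d g kk).comap (VV n d).subtype) e h CC_one
    (by
      rintro ⟨v, hv⟩
      obtain ⟨N, hN⟩ := (CC_unit (d := d) i₁ h1 hk hv).1
      refine ⟨N, ?_⟩
      change _ ∈ CC n m d g kk
      convert hN using 1
      funext z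
      simp [e])
    (by
      intro hh
      apply hc
      change _ ∈ CC n m d g kk at hh
      obtain ⟨σ0, σ, a, b, c⟩ := hh
      refine ⟨σ0, σ, a, b, fun z => ?_⟩
      rw [← c z]
      simp [h, e])
  obtain ⟨L', hL'⟩ := LinearMap.exists_extend L
  have hLL : ∀ v (hv : v ∈ VV n d), L' v = L ⟨v, hv⟩ := fun v hv => by
    rw [← hL']; rfl
  refine ⟨fun α β => cplx L' (mono α β), ⟨fun α β _ _ => cplx_mono L' α β, ?_, ?_, fun i => ?_⟩, ?_⟩
  · have e0 : (mono (0 : MIdx n) 0) = fun _ => ((1 : ℝ) : ℂ) := by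
      funext z; simp [mono, mpow_zero]
    change cplx L' (mono 0 0) = 1
    rw [e0, cplx_ofReal L' (fun _ => 1), hLL _ one_VV]
    exact_mod_cast hLe
  · rw [← momMatrix_onePoly]
    apply psd_of (d := d) (l := 0) (by omega) L' _ (onePoly_deg n)
    intro p hp
    rw [hLL _ (sqg_VV (l := 0) (by omega) _ (onePoly_deg n) p hp)]
    apply hLC
    change _ ∈ CC n m d g kk
    have := CC_sq (m := m) (g := g) (kk := kk) hp
    simpa [peval_onePoly] using this
  · have := hkkd i
    apply psd_of (d := d) (l := kk i) (by omega) L' _ (hg i)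
    intro p hp
    rw [hLL _ (sqg_VV (l := kk i) (by omega) _ (hg i) p hp)]
    apply hLC
    exact CC_sqg i hp
  · have e1 := Lam_peval (cplx L') f hf
    rw [Ly, ← e1, cplx_ofReal L' (fun z => peval f z), Complex.ofReal_re,
      hLL _ (peval_VV hkd f hf)]
    simp only [h, map_sub, map_smul, hLe, smul_eq_mul, mul_one] at hLh
    linarith

/-- Under the sphere assumption, strong duality holds at every order of the complex
hierarchy: `ρ_d* = ρ_d` for every `d ≥ d^min`, and this common value is never `−∞`. -/
theorem stmt14 (n m : ℕ) (f : MIdx n → MIdx n → ℂ) (k : ℕ)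
    (g : Fin m → MIdx n → MIdx n → ℂ) (kk : Fin m → ℕ)
    (hf : IsPolyDeg k f) (hftop : HasTopDeg k f)
    (hg : ∀ i, IsPolyDeg (kk i) (g i)) (hgtop : ∀ i, HasTopDeg (kk i) (g i))
    (dmin : ℕ) (hdmin : dmin = max k (Finset.univ.sup kk))
    (hK : IsCompact (Kset g))
    (R : ℝ) (hsphere : SphereAssumption n m g R) :
    ∀ d, dmin ≤ d →
      rhoSOS n m d f g kk = rhoMom n m d f g kk ∧ rhoMom n m d f g kk ≠ ⊥ := by
  intro d hd
  obtain ⟨hR, i₁, i₂, -, h1, -⟩ := hsphere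
  have hkd : k ≤ d := le_trans (le_max_left _ _) (hdmin ▸ hd)
  have hkkd : ∀ i, kk i ≤ d := fun i =>
    le_trans (Finset.le_sup (Finset.mem_univ i)) (le_trans (le_max_right _ _) (hdmin ▸ hd))
  have hk : kk i₁ ≤ 1 := by
    obtain ⟨α, β, ha, -, hne⟩ := hgtop i₁
    rw [h1] at hne
    rw [← ha]
    exact (sphere_deg hne).1
  have hweak : rhoSOS n m d f g kk ≤ rhoMom n m d f g kk := by
    apply sSup_le
    rintro x ⟨lam, hlam, rfl⟩
    apply le_sInf
    rintro x ⟨y, hy, rfl⟩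
    exact_mod_cast weak_duality hf hg hlam hy
  have hstrong : rhoMom n m d f g kk ≤ rhoSOS n m d f g kk := by
    by_contra! hlt
    obtain ⟨lam, hl1, hl2⟩ := EReal.lt_iff_exists_real_btwn.1 hlt
    by_cases hc : SOSCert n m d f g kk lam
    · have h6 : (lam : EReal) ≤ rhoSOS n m d f g kk := le_sSup ⟨lam, hc, rfl⟩
      exact absurd h6 (not_le.2 hl1)
    · obtain ⟨y, hy, hyl⟩ := strong hf hg hkd hkkd i₁ h1 hk hc
      have h3 : rhoMom n m d f g kk ≤ ((Ly f y : ℝ) : EReal) := sInf_le ⟨y, hy, rfl⟩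
      have h4 : ((Ly f y : ℝ) : EReal) ≤ (lam : EReal) := by exact_mod_cast hyl
      exact absurd (h3.trans h4) (not_le.2 hl2)
  refine ⟨le_antisymm hweak hstrong, ?_⟩
  obtain ⟨N, hN⟩ := (CC_unit (d := d) i₁ h1 hk (peval_VV hkd f hf)).1
  have hc : SOSCert n m d f g kk (-N) := by
    obtain ⟨σ0, σ, a, b, c⟩ := hN
    exact ⟨σ0, σ, a, b, fun z => by rw [← c z]; ring⟩
  have h5 : ((-N : ℝ) : EReal) ≤ rhoSOS n m d f g kk := le_sSup ⟨-N, hc, rfl⟩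
  intro hbot
  have := h5.trans hweak
  rw [hbot] at this
  exact EReal.coe_ne_bot _ (le_bot_iff.1 this)
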